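/- Assume r ≥ 2, n i ≠ −1 for all i, ∑_{i} n i = −2, and at most two indices i have n i odd. Then the index of the subgroup H in G equals ∏_{i < j} N i j (the product over all unordered pairs of distinct indices). -/

import Mathlib

/-- `N i j`: the gcd (as a nonnegative integer) of the family consisting of `n k` for
`k ∉ {i, j}` together with `n i + 1` and `n j + 1`. -/
def Npair {r : ℕ} (n : Fin r → ℤ) (i j : Fin r) : ℕ :=
  Nat.gcd ((Finset.univ \ {i, j}).gcd fun k => (n k).natAbs)
    (Nat.gcd (n i + 1).natAbs (n j + 1).natAbs)

/-- The element `m • e i` of `G = ∏_{j} ZMod |n j + 1|`: the `i`-th coordinate is the image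
of `m` in `ZMod |n i + 1|`, and all other coordinates are `0`. -/
def esingle {r : ℕ} (n : Fin r → ℤ) (i : Fin r) (m : ℤ) :
    (j : Fin r) → ZMod ((n j + 1).natAbs) :=
  Pi.single i (m : ZMod ((n i + 1).natAbs))

/-- `τ i j = (n j) • e i + (n i) • e j`. -/
def tau {r : ℕ} (n : Fin r → ℤ) (i j : Fin r) : (k : Fin r) → ZMod ((n k + 1).natAbs) :=
  esingle n i (n j) + esingle n j (n i)

/-- `H`: the subgroup of `G` generated by the elements `τ i j` over all pairs `i ≠ j`. -/
def Hsub {r : ℕ} (n : Fin r → ℤ) : AddSubgroup ((k : Fin r) → ZMod ((n k + 1).natAbs)) :=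
  AddSubgroup.closure {x | ∃ i j, i ≠ j ∧ x = tau n i j}

theorem Npair_dvd_add_one_left {r : ℕ} (n : Fin r → ℤ) (i j : Fin r) :
    Npair n i j ∣ (n i + 1).natAbs :=
  (Nat.gcd_dvd_right _ _).trans (Nat.gcd_dvd_left _ _)

theorem Npair_dvd_add_one_right {r : ℕ} (n : Fin r → ℤ) (i j : Fin r) :
    Npair n i j ∣ (n j + 1).natAbs :=
  (Nat.gcd_dvd_right _ _).trans (Nat.gcd_dvd_right _ _)

theorem Npair_dvd_of_ne {r : ℕ} (n : Fin r → ℤ) {i j k : Fin r} (hi : k ≠ i) (hj : k ≠ j) :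
    Npair n i j ∣ (n k).natAbs :=
  (Nat.gcd_dvd_left _ _).trans (Finset.gcd_dvd (by simp [hi, hj]))

/-- A prime dividing `Npair n i j` divides `n k + 1` for no `k` other than `i` and `j`. -/
theorem eq_or_eq_of_prime_dvd_Npair {r : ℕ} {n : Fin r → ℤ} {p : ℕ} (hp : p.Prime)
    {i j k : Fin r} (h : p ∣ Npair n i j) (hk : p ∣ (n k + 1).natAbs) : k = i ∨ k = j := by
  by_contra! hne
  have h1 := Int.natCast_dvd.2 (h.trans (Npair_dvd_of_ne n hne.1 hne.2))
  have h2 := (dvd_add_right h1).1 (Int.natCast_dvd.2 hk)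
  exact hp.one_lt.ne' (by simpa using Int.natCast_dvd.1 h2)

theorem Npair_coprime {r : ℕ} (n : Fin r → ℤ) {i j k l : Fin r} (hij : i < j) (hkl : k < l)
    (hne : (i, j) ≠ (k, l)) : Nat.Coprime (Npair n i j) (Npair n k l) := by
  refine Nat.coprime_of_dvd fun p hp h1 h2 => hne ?_
  have hk := eq_or_eq_of_prime_dvd_Npair hp h1 (h2.trans (Npair_dvd_add_one_left n k l))
  have hl := eq_or_eq_of_prime_dvd_Npair hp h1 (h2.trans (Npair_dvd_add_one_right n k l))
  grind

/-- If multiplication by integers prime to `p` is injective on `M`, and `e i : M` satisfy the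
defining relations of the quotient by `Hsub n`, then `∑ i, z i • e i` vanishes as soon as
`z i ≡ z j` modulo `Npair n i j` for all `i < j`. -/
theorem sum_smul_eq_zero_of_relations {r : ℕ} {n : Fin r → ℤ} (hsum : ∑ i, n i = -2)
    (hodd : (Finset.univ.filter fun i => Odd (n i)).card ≤ 2) {M : Type*} [AddCommGroup M]
    {p : ℕ} (hp : p.Prime) (hM : ∀ m : ℤ, ¬ (p : ℤ) ∣ m → ∀ x : M, m • x = 0 → x = 0)
    {e : Fin r → M} (h1 : ∀ i, (n i + 1) • e i = 0)
    (h2 : ∀ i j, i ≠ j → n j • e i + n i • e j = 0) {z : Fin r → ℤ}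
    (hz : ∀ i j, i < j → (Npair n i j : ℤ) ∣ z i - z j) : ∑ i, z i • e i = 0 := by
  set A : Finset (Fin r) := Finset.univ.filter fun i => (p : ℤ) ∣ n i + 1 with hA
  have memA : ∀ i, i ∈ A ↔ (p : ℤ) ∣ n i + 1 := by simp [hA]
  have hnot : ∀ i, i ∉ A → e i = 0 := fun i hi => hM _ (by rwa [memA] at hi) _ (h1 i)
  have hunit : ∀ i ∈ A, ¬ (p : ℤ) ∣ n i := fun i hi h => by
    have := (dvd_add_right h).1 ((memA i).1 hi)
    exact hp.one_lt.ne' (by simpa using Int.natCast_dvd.1 this)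
  have hpow : ∀ a k, k ∉ A → k ≠ a → n k • e a = 0 := fun a k hk hka => by
    simpa [hnot k hk] using h2 a k hka.symm
  have hzero : (∀ i ∈ A, e i = 0) → ∑ i, z i • e i = 0 := fun h =>
    Finset.sum_eq_zero fun i _ => by
      by_cases hi : i ∈ A
      · simp [h i hi]
      · simp [hnot i hi]
  rcases Nat.lt_or_ge 2 A.card with hcard | hcard
  · refine hzero fun c hc => ?_
    have hp2 : ¬ (p : ℤ) ∣ 2 := fun h => by
      have h' : p = 2 := (Nat.prime_dvd_prime_iff_eq hp Nat.prime_two).1 (by exact_mod_cast h)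
      refine absurd (Finset.card_le_card (fun i hi => ?_)) (not_le.2 (hodd.trans_lt hcard))
      have hi' := (memA i).1 hi
      simp only [Finset.mem_filter, Finset.mem_univ, true_and]
      rw [h'] at hi'
      rw [Int.odd_iff]
      push_cast at hi'
      omega
    obtain ⟨a, ha, b, hb, hab⟩ := Finset.one_lt_card.1
      (show 1 < (A.erase c).card by rw [Finset.card_erase_of_mem hc]; omega)
    rw [Finset.mem_erase] at ha hb
    have hpi : Prime (p : ℤ) := Nat.prime_iff_prime_int.1 hp
    refine hM (2 * (n a * n b)) (fun h => ?_) _ ?_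
    · rcases hpi.dvd_or_dvd h with h | h
      · exact hp2 h
      · rcases hpi.dvd_or_dvd h with h | h
        · exact hunit a ha.2 h
        · exact hunit b hb.2 h
    · linear_combination (norm := module) (n a) • h2 b c hb.1 + (n b) • h2 a c ha.1 -
        (n c) • h2 a b hab
  rcases Nat.lt_or_ge A.card 2 with hcard' | hcard'
  · refine hzero fun a ha => ?_
    have hk : ∀ k, k ≠ a → n k • e a = 0 := fun k hka =>
      hpow a k (fun hk => hka (Finset.card_le_one.1 (by omega) k hk a ha)) hka
    have hs : (∑ i, n i) • e a = n a • e a := by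
      rw [Finset.sum_smul]
      exact Finset.sum_eq_single a (fun k _ hka => hk k hka) (by simp)
    rw [hsum] at hs
    linear_combination (norm := module) -hs - h1 a
  · obtain ⟨a, b, hab, hAab⟩ : ∃ a b, a < b ∧ A = {a, b} := by
      obtain ⟨a, b, hab, h⟩ := Finset.card_eq_two.1 (le_antisymm hcard hcard')
      rcases lt_or_gt_of_ne hab with h' | h'
      · exact ⟨a, b, h', h⟩
      · exact ⟨b, a, h', by rw [h, Finset.pair_comm]⟩
    have hmem : ∀ k, k ∈ A ↔ k = a ∨ k = b := by simp [hAab]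
    have hb1 : (n b + 1) • e a = 0 := by
      refine hM (n b) (hunit b (by simp [hAab])) _ ?_
      linear_combination (norm := module) (n b + 1) • h2 a b hab.ne - (n a) • h1 b
    have ha1 : (n a + 1) • e b = 0 := by
      refine hM (n a) (hunit a (by simp [hAab])) _ ?_
      linear_combination (norm := module) (n a + 1) • h2 a b hab.ne - (n b) • h1 a
    have heb : e b = - e a := by
      linear_combination (norm := module) hb1 + ha1 - h2 a b hab.ne
    have hN : (Npair n a b : ℤ) • e a = 0 := by
      rw [natCast_zsmul, ← addOrderOf_dvd_iff_nsmul_eq_zero]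
      refine Nat.dvd_gcd (Finset.dvd_gcd fun k hk => ?_) (Nat.dvd_gcd ?_ ?_)
      · simp only [Finset.mem_sdiff, Finset.mem_univ, true_and, Finset.mem_insert,
          Finset.mem_singleton, not_or] at hk
        rw [← Int.natCast_dvd, addOrderOf_dvd_iff_zsmul_eq_zero]
        exact hpow a k (by simp [hmem, hk]) hk.1
      · rw [← Int.natCast_dvd, addOrderOf_dvd_iff_zsmul_eq_zero, h1]
      · rw [← Int.natCast_dvd, addOrderOf_dvd_iff_zsmul_eq_zero, hb1]
    obtain ⟨c, hc⟩ := hz a b hab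
    have hs : ∑ i, z i • e i = z a • e a + z b • e b := by
      rw [← Finset.sum_pair (f := fun i => z i • e i) hab.ne, ← hAab]
      exact (Finset.sum_subset (Finset.subset_univ A) fun i _ hi => by simp [hnot i hi]).symm
    rw [hs, heb, smul_neg, ← sub_eq_add_neg, ← sub_smul, hc, mul_comm, mul_smul, hN, smul_zero]

theorem esingle_eq_smul {r : ℕ} (n : Fin r → ℤ) (i : Fin r) (m : ℤ) :
    esingle n i m = m • esingle n i 1 := by
  simp [esingle, ← Pi.single_smul]

theorem add_one_smul_esingle {r : ℕ} (n : Fin r → ℤ) (i : Fin r) :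
    (n i + 1) • esingle n i 1 = 0 := by
  rw [← esingle_eq_smul, esingle, (ZMod.intCast_zmod_eq_zero_iff_dvd _ _).2, Pi.single_zero]
  exact Int.natAbs_dvd.2 dvd_rfl

theorem tau_eq {r : ℕ} (n : Fin r → ℤ) (i j : Fin r) :
    tau n i j = n j • esingle n i 1 + n i • esingle n j 1 := by
  rw [tau, esingle_eq_smul, esingle_eq_smul n j]

theorem eq_sum_smul_esingle {r : ℕ} (n z : Fin r → ℤ) :
    (fun i => (z i : ZMod (n i + 1).natAbs)) = ∑ i, z i • esingle n i 1 := by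
  simp_rw [← esingle_eq_smul, esingle]
  exact (Finset.univ_sum_single _).symm

/-- The elements of `K` up to multiplication by integers prime to `p`. -/
def AddSubgroup.localSaturation {G : Type*} [AddCommGroup G] (K : AddSubgroup G) {p : ℕ}
    (hp : p.Prime) : AddSubgroup G where
  carrier := {g | ∃ m : ℤ, ¬ (p : ℤ) ∣ m ∧ m • g ∈ K}
  zero_mem' := ⟨1, fun h => hp.one_lt.ne' (by simpa using Int.natCast_dvd.1 h), by simp⟩
  add_mem' := by
    rintro a b ⟨m, hm, ha⟩ ⟨l, hl, hb⟩
    refine ⟨m * l, fun h => ((Nat.prime_iff_prime_int.1 hp).dvd_or_dvd h).elim hm hl, ?_⟩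
    rw [smul_add]
    refine K.add_mem ?_ ?_
    · rw [mul_comm, mul_smul]
      exact K.zsmul_mem ha l
    · rw [mul_smul]
      exact K.zsmul_mem hb m
  neg_mem' := by
    rintro a ⟨m, hm, ha⟩
    exact ⟨m, hm, by simpa using ha⟩

theorem AddSubgroup.mem_of_forall_mem_localSaturation {G : Type*} [AddCommGroup G]
    {K : AddSubgroup G} {x : G} (h : ∀ (p : ℕ) (hp : p.Prime), x ∈ K.localSaturation hp) :
    x ∈ K := by
  rw [← QuotientAddGroup.eq_zero_iff, ← AddMonoid.addOrderOf_eq_one_iff]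
  by_contra hne
  obtain ⟨p, hp, hdvd⟩ := Nat.exists_prime_and_dvd hne
  obtain ⟨m, hm, hmx⟩ := h p hp
  refine hm ((Int.natCast_dvd_natCast.2 hdvd).trans ?_)
  rw [addOrderOf_dvd_iff_zsmul_eq_zero, ← QuotientAddGroup.mk_zsmul,
    QuotientAddGroup.eq_zero_iff]
  exact hmx

theorem AddSubgroup.quotient_localSaturation_eq_zero {G : Type*} [AddCommGroup G]
    (K : AddSubgroup G) {p : ℕ} (hp : p.Prime) (m : ℤ) (hm : ¬ (p : ℤ) ∣ m)
    (x : G ⧸ K.localSaturation hp) (hx : m • x = 0) : x = 0 := by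
  induction x using QuotientAddGroup.induction_on with
  | H g =>
    rw [← QuotientAddGroup.mk_zsmul, QuotientAddGroup.eq_zero_iff] at hx
    obtain ⟨l, hl, h⟩ := hx
    rw [QuotientAddGroup.eq_zero_iff]
    refine ⟨l * m, fun h => ((Nat.prime_iff_prime_int.1 hp).dvd_or_dvd h).elim hl hm, ?_⟩
    rwa [mul_smul]

theorem AddSubgroup.le_localSaturation {G : Type*} [AddCommGroup G]
    (K : AddSubgroup G) {p : ℕ} (hp : p.Prime) : K ≤ K.localSaturation hp := fun g hg =>
  ⟨1, fun h => hp.one_lt.ne' (by simpa using Int.natCast_dvd.1 h), by simpa using hg⟩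

/-- The homomorphism sending `x` to the family of differences `x i - x j` modulo `Npair n i j`,
over all `i < j`. -/
def pairDiff {r : ℕ} (n : Fin r → ℤ) : ((k : Fin r) → ZMod ((n k + 1).natAbs)) →+
    ((q : {q : Fin r × Fin r // q ∈ Finset.univ.filter fun q : Fin r × Fin r => q.1 < q.2}) →
      ZMod (Npair n q.1.1 q.1.2)) :=
  AddMonoidHom.pi fun q =>
    (ZMod.castHom (Npair_dvd_add_one_left n q.1.1 q.1.2) _).toAddMonoidHom.comp
        (Pi.evalAddMonoidHom _ q.1.1) -
      (ZMod.castHom (Npair_dvd_add_one_right n q.1.1 q.1.2) _).toAddMonoidHom.comp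
        (Pi.evalAddMonoidHom _ q.1.2)

theorem pairDiff_intCast {r : ℕ} (n z : Fin r → ℤ)
    (q : {q : Fin r × Fin r // q ∈ Finset.univ.filter fun q : Fin r × Fin r => q.1 < q.2}) :
    pairDiff n (fun i => (z i : ZMod (n i + 1).natAbs)) q = ((z q.1.1 - z q.1.2 : ℤ) : ZMod _) := by
  rw [Int.cast_sub]
  exact congrArg₂ (· - ·)
    (map_intCast (ZMod.castHom (Npair_dvd_add_one_left n q.1.1 q.1.2)
      (ZMod (Npair n q.1.1 q.1.2))) _)
    (map_intCast (ZMod.castHom (Npair_dvd_add_one_right n q.1.1 q.1.2)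
      (ZMod (Npair n q.1.1 q.1.2))) _)

theorem pairDiff_surjective {r : ℕ} (n : Fin r → ℤ) : Function.Surjective (pairDiff n) := by
  intro y
  have hcop : Pairwise (Function.onFun Nat.Coprime fun q : {q : Fin r × Fin r //
      q ∈ Finset.univ.filter fun q : Fin r × Fin r => q.1 < q.2} =>
        Npair n q.1.1 q.1.2) := fun q q' hne =>
    Npair_coprime n (Finset.mem_filter.1 q.2).2 (Finset.mem_filter.1 q'.2).2
      fun h => hne (Subtype.ext h)
  have hcrt : ∀ k : Fin r, ∃ z : ℤ, ∀ q : {q : Fin r × Fin r //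
      q ∈ Finset.univ.filter fun q : Fin r × Fin r => q.1 < q.2},
        (z : ZMod (Npair n q.1.1 q.1.2)) = if q.1.1 = k then y q else 0 := fun k => by
    obtain ⟨z, hz⟩ := ZMod.intCast_surjective
      ((ZMod.prodEquivPi _ hcop).symm fun q => if q.1.1 = k then y q else 0)
    refine ⟨z, fun q => ?_⟩
    have h := congrFun ((ZMod.prodEquivPi _ hcop).symm_apply_eq.1 hz.symm) q
    rw [h, map_intCast, Pi.intCast_apply]
  choose z hz using hcrt
  refine ⟨fun i => (z i : ZMod _), funext fun q => ?_⟩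
  rw [pairDiff_intCast, Int.cast_sub, hz, hz, if_pos rfl,
    if_neg (Finset.mem_filter.1 q.2).2.ne, sub_zero]

theorem Hsub_le_ker_pairDiff {r : ℕ} (n : Fin r → ℤ) : Hsub n ≤ (pairDiff n).ker := by
  rw [Hsub, AddSubgroup.closure_le]
  rintro _ ⟨i, j, hij, rfl⟩
  have hz : tau n i j = fun k => (((Pi.single i (n j) + Pi.single j (n i) : Fin r → ℤ) k : ℤ) :
      ZMod (n k + 1).natAbs) := by
    funext k
    have h : ∀ (i : Fin r) (m : ℤ), (Pi.single i (m : ZMod (n i + 1).natAbs) :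
        (k : Fin r) → ZMod (n k + 1).natAbs) k = ((Pi.single i m : Fin r → ℤ) k : ℤ) :=
      fun i m => by
        rcases eq_or_ne k i with rfl | hk
        · simp
        · simp [hk]
    rw [tau, Pi.add_apply, esingle, esingle, h, h, Pi.add_apply, Int.cast_add]
  rw [hz, SetLike.mem_coe, AddMonoidHom.mem_ker]
  funext ⟨⟨a, b⟩, hab⟩
  have hlt : a < b := (Finset.mem_filter.1 hab).2
  rw [pairDiff_intCast, Pi.zero_apply]
  have ha : (n a : ZMod (Npair n a b)) + 1 = 0 := by
    exact_mod_cast (ZMod.intCast_zmod_eq_zero_iff_dvd (n a + 1) _).2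
      (Int.natCast_dvd.2 (Npair_dvd_add_one_left n a b))
  have hb : (n b : ZMod (Npair n a b)) + 1 = 0 := by
    exact_mod_cast (ZMod.intCast_zmod_eq_zero_iff_dvd (n b + 1) _).2
      (Int.natCast_dvd.2 (Npair_dvd_add_one_right n a b))
  have hk : ∀ k, k ≠ a → k ≠ b → (n k : ZMod (Npair n a b)) = 0 := fun k h h' =>
    (ZMod.intCast_zmod_eq_zero_iff_dvd (n k) _).2 (Int.natCast_dvd.2 (Npair_dvd_of_ne n h h'))
  simp only [Pi.add_apply, Pi.single_apply, Int.cast_sub, Int.cast_add, Int.cast_ite,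
    Int.cast_zero]
  grind

theorem ker_pairDiff_le_Hsub {r : ℕ} {n : Fin r → ℤ} (hsum : ∑ i, n i = -2)
    (hodd : (Finset.univ.filter fun i => Odd (n i)).card ≤ 2) :
    (pairDiff n).ker ≤ Hsub n := by
  intro x hx
  obtain ⟨z, rfl⟩ : ∃ z : Fin r → ℤ, (fun i => (z i : ZMod (n i + 1).natAbs)) = x := by
    choose z hz using fun i => ZMod.intCast_surjective (x i)
    exact ⟨z, funext hz⟩
  refine AddSubgroup.mem_of_forall_mem_localSaturation fun p hp => ?_
  rw [eq_sum_smul_esingle, ← QuotientAddGroup.eq_zero_iff]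
  set f := QuotientAddGroup.mk' ((Hsub n).localSaturation hp)
  change f _ = 0
  rw [map_sum]
  simp_rw [map_zsmul]
  refine sum_smul_eq_zero_of_relations hsum hodd hp
    (AddSubgroup.quotient_localSaturation_eq_zero _ hp) (fun i => ?_) (fun i j hij => ?_)
    fun i j hij => ?_
  · rw [← map_zsmul, add_one_smul_esingle, map_zero]
  · rw [← map_zsmul, ← map_zsmul, ← map_add, ← tau_eq]
    exact (QuotientAddGroup.eq_zero_iff _).2 (AddSubgroup.le_localSaturation _ hp
      (AddSubgroup.subset_closure ⟨i, j, hij, rfl⟩))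
  · rw [← ZMod.intCast_zmod_eq_zero_iff_dvd]
    have h := congrFun ((AddMonoidHom.mem_ker).1 hx) ⟨(i, j), by simpa using hij⟩
    rwa [pairDiff_intCast] at h

/-- If `r ≥ 2`, no `n i` equals `-1`, `∑ n i = -2` and at most two indices `i` have `n i` odd,
then the index of `H` in `G` equals `∏_{i < j} N i j`. -/
theorem Hsub_index_eq_prod {r : ℕ} (hr : 2 ≤ r) (n : Fin r → ℤ)
    (hn : ∀ i, n i ≠ -1) (hsum : ∑ i, n i = -2)
    (hodd : (Finset.univ.filter fun i => Odd (n i)).card ≤ 2) :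
    (Hsub n).index =
      ∏ p ∈ Finset.univ.filter (fun p : Fin r × Fin r => p.1 < p.2), Npair n p.1 p.2 := by
  rw [le_antisymm (Hsub_le_ker_pairDiff n) (ker_pairDiff_le_Hsub hsum hodd),
    AddSubgroup.index_ker, AddMonoidHom.range_eq_top.2 (pairDiff_surjective n),
    AddSubgroup.card_top, Nat.card_pi]
  simp_rw [Nat.card_zmod]
  exact Finset.prod_coe_sort _ fun q : Fin r × Fin r => Npair n q.1 q.2
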